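/- arXiv:1506.05415 — 2 statements merged into one kernel-verified Lean document; each statement's English description precedes it below -/
import Mathlib

section
/- Let 𝒢 be a groupoid with set of objects M which is transitive (for all x, y ∈ M there exists a morphism x ⟶ y) and admits a bisection through each arrow (for every morphism g : x ⟶ y there exists σ ∈ Bis(𝒢) with f_σ(x) = y and σ(x) = g). Fix m ∈ M. Then the left action of Bis(𝒢) on the coset space Bis(𝒢)/Bis_m(𝒢) given by σ · (τ ⋆ Bis_m(𝒢)) := (σ ⋆ τ) ⋆ Bis_m(𝒢) is effective: if σ ∈ Bis(𝒢) satisfies (σ ⋆ τ) ⋆ Bis_m(𝒢) = τ ⋆ Bis_m(𝒢) for every τ ∈ Bis(𝒢), then σ is the unit bisection. -/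
open CategoryTheory

/-- A bisection of a groupoid with objects `M`: a bijection `toEquiv` of the
objects together with, for each object `x`, a morphism `x ⟶ toEquiv x`. -/
structure Bisection (M : Type*) [Groupoid M] where
  toEquiv : M ≃ M
  arr : ∀ x : M, x ⟶ toEquiv x

namespace Bisection

variable {M : Type*} [Groupoid M]

/-- The product `σ ⋆ τ` of bisections: `(σ ⋆ τ)(x) = τ(x) ≫ σ(f_τ x)`,
with underlying bijection `f_σ ∘ f_τ`. -/
def mul (σ τ : Bisection M) : Bisection M where
  toEquiv := τ.toEquiv.trans σ.toEquiv
  arr x := τ.arr x ≫ σ.arr (τ.toEquiv x)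

/-- The unit bisection: identity bijection and identity morphisms. -/
def one (M : Type*) [Groupoid M] : Bisection M where
  toEquiv := Equiv.refl M
  arr x := 𝟙 x

/-- The inverse bisection `σ⁻¹`, with `f_{σ⁻¹} = f_σ⁻¹` and
`σ⁻¹(x) = inv (σ (f_σ⁻¹ x))` (up to the canonical identification). -/
def inv (σ : Bisection M) : Bisection M where
  toEquiv := σ.toEquiv.symm
  arr x := eqToHom (σ.toEquiv.apply_symm_apply x).symm ≫ Groupoid.inv (σ.arr (σ.toEquiv.symm x))

/-- `σ` fixes the point `m`. -/
def IsLoop (m : M) (σ : Bisection M) : Prop := σ.toEquiv m = m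

/-- `σ` takes the value `𝟙 m` at `m`. -/
def IsUnitAt (m : M) (σ : Bisection M) : Prop :=
  ∃ h : σ.toEquiv m = m, σ.arr m ≫ eqToHom h = 𝟙 m

end Bisection

namespace Bisection

/-- If `ρ⁻¹ ⋆ τ` is a unit at `m`, then `ρ` and `τ` agree at `m`. -/
theorem IsUnitAt.arr_eq {M : Type*} [Groupoid M] {m : M} {ρ τ : Bisection M}
    (h : IsUnitAt m (ρ.inv.mul τ)) :
    ∃ e : ρ.toEquiv m = τ.toEquiv m, ρ.arr m ≫ eqToHom e = τ.arr m := by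
  obtain ⟨h, hu⟩ := h
  have key : ∀ (p : M) (hp : p = m) (e : τ.toEquiv m = ρ.toEquiv p),
      (τ.arr m ≫ eqToHom e ≫ Groupoid.inv (ρ.arr p)) ≫ eqToHom hp = 𝟙 m →
      ∃ e : ρ.toEquiv m = τ.toEquiv m, ρ.arr m ≫ eqToHom e = τ.arr m := by
    rintro p rfl e hu
    refine ⟨e.symm, ?_⟩
    rw [eqToHom_refl, Category.comp_id, ← Category.assoc, Groupoid.inv_eq_inv,
      IsIso.comp_inv_eq, Category.id_comp] at hu
    simp [← hu]
  exact key _ h (ρ.toEquiv.apply_symm_apply _).symm hu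

/-- A bisection whose arrows are all identities is the unit bisection. -/
theorem eq_one_of_isUnitAt {M : Type*} [Groupoid M] {σ : Bisection M}
    (h : ∀ x, IsUnitAt x σ) : σ = one M := by
  obtain ⟨f, a⟩ := σ
  obtain rfl : f = Equiv.refl M := Equiv.ext fun x => (h x).1
  have ha : a = fun x => 𝟙 x := by
    funext x
    obtain ⟨_, hx⟩ := h x
    exact (Category.comp_id (a x)).symm.trans hx
  rw [ha]
  rfl

end Bisection

/-- If the groupoid is transitive and admits a bisection through
each arrow, then the left action of `Bis(𝒢)` on `Bis(𝒢)/Bis_m(𝒢)` given by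
`σ · [τ] := [σ ⋆ τ]` is effective: if `σ` fixes every coset, then `σ` is the
unit bisection. -/
theorem coset_left_action_effective {M : Type*} [Groupoid M] (m : M)
    (htrans : ∀ x y : M, Nonempty (x ⟶ y))
    (hbis : ∀ (x y : M) (g : x ⟶ y), ∃ σ : Bisection M, ∃ h : σ.toEquiv x = y,
        σ.arr x ≫ eqToHom h = g) :
    ∀ σ : Bisection M,
      (∀ τ : Bisection M, Bisection.IsUnitAt m ((σ.mul τ).inv.mul τ)) →
      σ = Bisection.one M := by
  intro σ hσ
  refine Bisection.eq_one_of_isUnitAt fun x => ?_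
  obtain ⟨g⟩ := htrans m x
  obtain ⟨τ, rfl, -⟩ := hbis m x g
  obtain ⟨e, he⟩ := (hσ τ).arr_eq
  refine ⟨e, (cancel_epi (τ.arr m)).1 ?_⟩
  rw [Category.comp_id, ← Category.assoc]
  exact he
end

section
/- Let 𝒢 be a groupoid with set of objects M, fix m ∈ M, and suppose the induced action of Bis(𝒢) on M given by σ · x := f_σ(x) is transitive. Then the image of the joint evaluation map Bis(𝒢) × M → Mor(𝒢), (σ, x) ↦ σ(x), equals the set of all 'divisions' at m: a morphism g of 𝒢 satisfies g = σ(x) for some σ ∈ Bis(𝒢) and x ∈ M if and only if there exist σ', τ ∈ Bis(𝒢) with g = inv(τ(m)) ≫ σ'(m) (a morphism f_τ(m) ⟶ f_{σ'}(m)). -/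
open CategoryTheory

namespace Bisection

/-- The value of `σ ⋆ τ⁻¹` at `f_τ m` is the division `inv(τ(m)) ≫ σ(m)`. -/
theorem mul_inv_arr_apply {M : Type*} [Groupoid M] (σ τ : Bisection M) (m : M) :
    (⟨τ.toEquiv m, (σ.mul τ.inv).toEquiv (τ.toEquiv m), (σ.mul τ.inv).arr (τ.toEquiv m)⟩
      : Σ p : M, Σ q : M, p ⟶ q) =
    ⟨τ.toEquiv m, σ.toEquiv m, Groupoid.inv (τ.arr m) ≫ σ.arr m⟩ := by
  have key : ∀ (n : M) (_ : n = m) (e : τ.toEquiv m = τ.toEquiv n),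
      (⟨τ.toEquiv m, σ.toEquiv n, (eqToHom e ≫ Groupoid.inv (τ.arr n)) ≫ σ.arr n⟩
        : Σ p : M, Σ q : M, p ⟶ q) =
      ⟨τ.toEquiv m, σ.toEquiv m, Groupoid.inv (τ.arr m) ≫ σ.arr m⟩ := by
    rintro n rfl e
    simp
  exact key _ (τ.toEquiv.symm_apply_apply m) _

end Bisection

/-- If the action of `Bis(𝒢)` on the objects, `σ · x := f_σ(x)`,
is transitive, then the image of the joint evaluation map
`Bis(𝒢) × M → Mor(𝒢)`, `(σ, x) ↦ σ(x)`, equals the set of divisions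
`inv(τ(m)) ≫ σ'(m)` at the fixed point `m`. -/
theorem eval_image_eq_divisions {M : Type*} [Groupoid M] (m : M)
    (htrans : ∀ x y : M, ∃ σ : Bisection M, σ.toEquiv x = y) :
    ∀ (a b : M) (g : a ⟶ b),
      ((∃ (σ : Bisection M) (x : M),
          (⟨x, σ.toEquiv x, σ.arr x⟩ : Σ p : M, Σ q : M, p ⟶ q) = ⟨a, b, g⟩)
        ↔ (∃ σ' τ : Bisection M,
          (⟨τ.toEquiv m, σ'.toEquiv m, Groupoid.inv (τ.arr m) ≫ σ'.arr m⟩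
              : Σ p : M, Σ q : M, p ⟶ q) = ⟨a, b, g⟩)) := by
  intro a b g
  constructor
  · rintro ⟨σ, x, h⟩
    obtain ⟨τ, rfl⟩ := htrans m x
    refine ⟨σ.mul τ, τ, ?_⟩
    rw [← h]
    simp [Bisection.mul]
  · rintro ⟨σ', τ, h⟩
    exact ⟨σ'.mul τ.inv, τ.toEquiv m, (Bisection.mul_inv_arr_apply σ' τ m).trans h⟩
end
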